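/- A point x ∈ Rep(Q̄,α) is stable — meaning its G-orbit is Zariski-closed in Rep(Q̄,α) and its stabilizer in G/ℂ× is finite — if and only if x is an irreducible representation of Q̄. -/

import Mathlib

/-!
STATEMENT 3: A point `x ∈ Rep(Q̄,α)` is stable (its G-orbit is Zariski-closed and its
stabilizer in `G/ℂ×` is finite) if and only if `x` is an irreducible representation.
-/

open Matrix BigOperators

/-- A finite quiver. -/
structure FinQuiver where
  V : Type
  E : Type
  [fintypeV : Fintype V]
  [decEqV : DecidableEq V]
  [fintypeE : Fintype E]
  [decEqE : DecidableEq E]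
  src : E → V
  tgt : E → V

attribute [instance] FinQuiver.fintypeV FinQuiver.decEqV FinQuiver.fintypeE FinQuiver.decEqE

namespace FinQuiver

variable (Q : FinQuiver) (α : Q.V → ℕ)

/-- The representation space of the double quiver `Q̄` with dimension vector `α`. -/
abbrev Rep :=
  ∀ e : Q.E, Matrix (Fin (α (Q.tgt e))) (Fin (α (Q.src e))) ℂ ×
    Matrix (Fin (α (Q.src e))) (Fin (α (Q.tgt e))) ℂ

/-- The group `G = ∏_{a ∈ Q₀} GL(α_a, ℂ)`. -/
abbrev GGroup := ∀ a : Q.V, (Matrix (Fin (α a)) (Fin (α a)) ℂ)ˣ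

variable {Q α}

/-- The action of `G` on `Rep(Q̄,α)`. -/
noncomputable def act (g : Q.GGroup α) (x : Q.Rep α) : Q.Rep α := fun e =>
  ((g (Q.tgt e)).val * (x e).1 * ((g (Q.src e))⁻¹).val,
   (g (Q.src e)).val * (x e).2 * ((g (Q.tgt e))⁻¹).val)

variable (Q α)

/-- The set of linear coordinates on `Rep(Q̄,α)`. -/
def Coord :=
  Σ e : Q.E, (Fin (α (Q.tgt e)) × Fin (α (Q.src e))) ⊕ (Fin (α (Q.src e)) × Fin (α (Q.tgt e)))

variable {Q α}

/-- Reading the coordinates of a point of `Rep(Q̄,α)`. -/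
def coords (x : Q.Rep α) : Coord Q α → ℂ
  | ⟨e, .inl (i, j)⟩ => (x e).1 i j
  | ⟨e, .inr (i, j)⟩ => (x e).2 i j

/-- A subset of `Rep(Q̄,α)` is Zariski closed iff it is the common zero set of a family
of polynomials in the coordinates. -/
def ZariskiClosed (S : Set (Q.Rep α)) : Prop :=
  ∃ P : Set (MvPolynomial (Coord Q α) ℂ),
    S = {x | ∀ f ∈ P, MvPolynomial.eval (coords x) f = 0}

/-- The `G`-orbit of a point. -/
def orbit (x : Q.Rep α) : Set (Q.Rep α) := Set.range fun g : Q.GGroup α => act g x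

/-- The diagonal scalar subgroup `ℂ× ⊆ G`. -/
noncomputable def scal (c : ℂˣ) : Q.GGroup α := fun a =>
  Units.map (algebraMap ℂ (Matrix (Fin (α a)) (Fin (α a)) ℂ)).toMonoidHom c

/-- The stabilizer of `x` in `G/ℂ×` is finite: finitely many classes modulo the scalar
subgroup cover the stabilizer. -/
def FiniteStabilizerModScalars (x : Q.Rep α) : Prop :=
  ∃ s : Set (Q.GGroup α), s.Finite ∧
    ∀ g : Q.GGroup α, act g x = x → ∃ h ∈ s, ∃ c : ℂˣ, g = scal c * h

/-- `x` is an irreducible representation of the double quiver: the only collections of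
subspaces `W_a ⊆ ℂ^{α_a}` invariant under all components of `x` are `0` and everything. -/
def Irred (x : Q.Rep α) : Prop :=
  ∀ W : ∀ a : Q.V, Submodule ℂ (Fin (α a) → ℂ),
    (∀ e : Q.E, (∀ v ∈ W (Q.src e), (x e).1.mulVec v ∈ W (Q.tgt e)) ∧
                (∀ v ∈ W (Q.tgt e), (x e).2.mulVec v ∈ W (Q.src e))) →
    (∀ a, W a = ⊥) ∨ (∀ a, W a = ⊤)

end FinQuiver

open FinQuiver

/-! ### Burnside's theorem and conjugacy of matrix representations -/

/-- **Burnside's theorem**: a subalgebra of `End K V` without nontrivial invariant subspaces is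
everything. -/
theorem Subalgebra.eq_top_of_forall_invariant {K V : Type*} [Field K] [IsAlgClosed K]
    [AddCommGroup V] [Module K V] [FiniteDimensional K V] (B : Subalgebra K (Module.End K V))
    (hB : ∀ U : Submodule K V, (∀ b ∈ B, ∀ v ∈ U, b v ∈ U) → U = ⊥ ∨ U = ⊤) : B = ⊤ := by
  rcases subsingleton_or_nontrivial V with hV | hV
  · refine eq_top_iff.2 fun f _ => ?_
    rw [Subsingleton.elim f 0]
    exact B.zero_mem
  have hsimple : IsSimpleModule B V := by
    rw [isSimpleModule_iff]
    refine { eq_bot_or_eq_top := fun N => ?_ }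
    rcases hB (N.restrictScalars K) fun b hb v hv => N.smul_mem ⟨b, hb⟩ hv with h | h
    · exact .inl ((Submodule.restrictScalars_eq_bot_iff K B V).1 h)
    · exact .inr ((Submodule.restrictScalars_eq_top_iff K B V).1 h)
  let β := Module.finBasis K V
  set ι := Fin (Module.finrank K V)
  let m : ι → V := β
  have key : Submodule.span B {m} = ⊤ := by
    obtain ⟨N', hN'⟩ := exists_isCompl (Submodule.span B {m})
    let π := N'.projection _ hN'.symm
    have hπm : π m = 0 := by
      simp [π, Submodule.mem_span_singleton_self m]
    have hπ : π = 0 := by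
      have hrow : ∀ j : ι, LinearMap.proj j ∘ₗ π = 0 := by
        intro j
        have hc : ∀ i : ι, ∃ c : K, algebraMap K (Module.End B V) c =
            LinearMap.proj j ∘ₗ π ∘ₗ LinearMap.single B (fun _ : ι => V) i := fun i =>
          (IsSimpleModule.algebraMap_end_bijective_of_isAlgClosed K).2 _
        choose c hc using hc
        have hval : ∀ v : ι → V, π v j = ∑ i, c i • v i := by
          intro v
          have hv : v = ∑ i, Pi.single i (v i) := (Finset.univ_sum_single v).symm
          conv_lhs => rw [hv, map_sum, Finset.sum_apply]
          refine Finset.sum_congr rfl fun i _ => ?_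
          exact (congrArg (fun f : Module.End B V => f (v i)) (hc i)).symm
        have hc0 : ∀ i, c i = 0 :=
          Fintype.linearIndependent_iff.1 β.linearIndependent c
            (by rw [← hval m, hπm]; rfl)
        ext1 i
        ext v
        simp [hval, hc0]
      refine LinearMap.ext fun v => funext fun j => ?_
      exact congrArg (fun f => f v) (hrow j)
    rw [eq_top_iff]
    intro v _
    have : π v = 0 := by rw [hπ]; rfl
    simpa [π] using this
  refine eq_top_iff.2 fun f _ => ?_
  have hf : (fun i => f (m i)) ∈ Submodule.span B {m} := key ▸ Submodule.mem_top
  obtain ⟨b, hb⟩ := Submodule.mem_span_singleton.1 hf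
  have : f = b := β.ext fun i => (congrFun hb i).symm
  exact this ▸ b.2

/-- Two matrix representations with the same character, one of which is surjective, are
conjugate. -/
theorem AlgHom.exists_conj_of_trace_eq {K A n : Type*} [Field K] [Ring A] [Algebra K A]
    [Fintype n] [DecidableEq n] (f g : A →ₐ[K] Matrix n n K) (hf : Function.Surjective f)
    (h : ∀ w, (g w).trace = (f w).trace) :
    ∃ T T' : Matrix n n K, T * T' = 1 ∧ T' * T = 1 ∧ ∀ w, g w = T * f w * T' := by
  have ker_le : ∀ (f g : A →ₐ[K] Matrix n n K), Function.Surjective f →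
      (∀ w, (g w).trace = (f w).trace) → ∀ a, g a = 0 → f a = 0 := by
    intro f g hf h a ha
    rw [Matrix.ext_iff_trace_mul_right]
    intro m
    obtain ⟨b, rfl⟩ := hf m
    rw [← map_mul, ← h, map_mul, ha]
    simp
  obtain ⟨s, hs⟩ := f.toLinearMap.exists_rightInverse_of_surjective
    (LinearMap.range_eq_top.2 hf)
  have hs' : ∀ m, f (s m) = m := fun m => LinearMap.congr_fun hs m
  have hinj : Function.Injective (g.toLinearMap ∘ₗ s) := by
    rw [injective_iff_map_eq_zero]
    intro m hm
    rw [← hs' m]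
    exact ker_le f g hf h _ hm
  have hsurj := LinearMap.surjective_of_injective hinj
  have hg : Function.Surjective g := fun m => (hsurj m).imp' s fun _ => id
  have hgs : ∀ w, g (s (f w)) = g w := by
    intro w
    rw [← sub_eq_zero, ← map_sub]
    refine ker_le g f hg (fun w => (h w).symm) _ ?_
    rw [map_sub, hs', sub_self]
  let σ : Matrix n n K ≃ₐ[K] Matrix n n K := AlgEquiv.ofBijective
    (AlgHom.ofLinearMap (g.toLinearMap ∘ₗ s)
      (by
        have := hgs 1
        rwa [map_one f, map_one g] at this)
      (by
        intro a b
        have := hgs (s a * s b)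
        rwa [map_mul f, map_mul g, hs', hs'] at this)) ⟨hinj, hsurj⟩
  have hσ : ∀ w, g w = σ (f w) := fun w => (hgs w).symm
  let L : Matrix n n K ≃ₐ[K] Module.End K (n → K) := Matrix.toLinAlgEquiv'
  obtain ⟨T, hT⟩ := ((L.symm.trans σ).trans L).eq_linearEquivConjAlgEquiv
  refine ⟨L.symm T.toLinearMap, L.symm T.symm.toLinearMap, ?_, ?_, fun w => ?_⟩
  · rw [← map_mul]
    convert map_one L.symm
    exact LinearMap.ext fun v => by simp
  · rw [← map_mul]
    convert map_one L.symm
    exact LinearMap.ext fun v => by simp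
  · apply L.injective
    have := congrArg (fun F => F (L (f w))) hT
    simp only [AlgEquiv.trans_apply, AlgEquiv.symm_apply_apply] at this
    rw [hσ, this, map_mul, map_mul, L.apply_symm_apply, L.apply_symm_apply]
    rfl

namespace FinQuiver

variable {Q : FinQuiver} {α : Q.V → ℕ}

/-! ### The total representation on the direct sum of the vertex spaces -/

variable (α) in
/-- The inclusion of the vertex space at `a` in the direct sum of all vertex spaces. -/
def incl (R : Type*) [CommRing R] (a : Q.V) : Matrix (Σ a, Fin (α a)) (Fin (α a)) R :=
  (1 : Matrix (Σ a, Fin (α a)) (Σ a, Fin (α a)) R).submatrix id fun i => ⟨a, i⟩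

theorem incl_transpose_mul_self (R : Type*) [CommRing R] (a : Q.V) :
    (incl α R a)ᵀ * incl α R a = 1 := by
  ext i j
  simp [incl, Matrix.mul_apply, Matrix.one_apply]

theorem sum_incl_mul_transpose (R : Type*) [CommRing R] :
    ∑ a, incl α R a * (incl α R a)ᵀ = 1 := by
  ext p q
  have h : ((1 : Matrix (Σ a, Fin (α a)) (Σ a, Fin (α a)) R) *
      (1 : Matrix (Σ a, Fin (α a)) (Σ a, Fin (α a)) R)ᵀ) p q =
      (1 : Matrix (Σ a, Fin (α a)) (Σ a, Fin (α a)) R) p q := by simp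
  rw [Matrix.mul_apply, Fintype.sum_sigma] at h
  rw [Matrix.sum_apply]
  exact h

theorem blockDiagonal'_mul_incl {R : Type*} [CommRing R]
    (M : ∀ a : Q.V, Matrix (Fin (α a)) (Fin (α a)) R) (a : Q.V) :
    Matrix.blockDiagonal' M * incl α R a = incl α R a * M a := by
  ext ⟨b, i⟩ j
  have h : (Matrix.blockDiagonal' M * incl α R a) ⟨b, i⟩ j =
      Matrix.blockDiagonal' M ⟨b, i⟩ ⟨a, j⟩ := by
    simp [incl, Matrix.mul_apply, Matrix.one_apply]
  rw [h]
  by_cases hb : b = a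
  · subst hb
    simp [incl, Matrix.mul_apply, Matrix.one_apply]
  · simp [incl, Matrix.mul_apply, hb, Matrix.blockDiagonal'_apply_ne]

theorem incl_transpose_mul_blockDiagonal' {R : Type*} [CommRing R]
    (M : ∀ a : Q.V, Matrix (Fin (α a)) (Fin (α a)) R) (a : Q.V) :
    (incl α R a)ᵀ * Matrix.blockDiagonal' M = M a * (incl α R a)ᵀ := by
  have := congrArg Matrix.transpose (blockDiagonal'_mul_incl (fun a => (M a)ᵀ) a)
  rwa [Matrix.transpose_mul, Matrix.transpose_mul, ← Matrix.blockDiagonal'_transpose,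
    Matrix.transpose_transpose, Matrix.transpose_transpose] at this

/-- The generators of the path algebra of the double quiver acting on the direct sum of the
vertex spaces: arrows, reversed arrows and vertex idempotents. -/
def gen {R : Type*} [CommRing R]
    (u : ∀ e : Q.E, Matrix (Fin (α (Q.tgt e))) (Fin (α (Q.src e))) R)
    (v : ∀ e : Q.E, Matrix (Fin (α (Q.src e))) (Fin (α (Q.tgt e))) R) :
    Q.E ⊕ Q.E ⊕ Q.V → Matrix (Σ a, Fin (α a)) (Σ a, Fin (α a)) R
  | .inl e => incl α R (Q.tgt e) * u e * (incl α R (Q.src e))ᵀ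
  | .inr (.inl e) => incl α R (Q.src e) * v e * (incl α R (Q.tgt e))ᵀ
  | .inr (.inr a) => incl α R a * (incl α R a)ᵀ

/-- The action of the free algebra on the direct sum of the vertex spaces. -/
noncomputable def total (x : Q.Rep α) : FreeAlgebra ℂ (Q.E ⊕ Q.E ⊕ Q.V) →ₐ[ℂ]
    Matrix (Σ a, Fin (α a)) (Σ a, Fin (α a)) ℂ :=
  FreeAlgebra.lift ℂ (gen (fun e => (x e).1) (fun e => (x e).2))

variable (Q α) in
/-- The action of the free algebra for the generic point of the representation space. -/
noncomputable def genericTotal : FreeAlgebra ℂ (Q.E ⊕ Q.E ⊕ Q.V) →ₐ[ℂ]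
    Matrix (Σ a, Fin (α a)) (Σ a, Fin (α a)) (MvPolynomial (Coord Q α) ℂ) :=
  FreeAlgebra.lift ℂ (gen
    (fun e => Matrix.of fun i j => MvPolynomial.X (⟨e, .inl (i, j)⟩ : Coord Q α))
    (fun e => Matrix.of fun i j => MvPolynomial.X (⟨e, .inr (i, j)⟩ : Coord Q α)))

theorem total_eq_map_genericTotal (x : Q.Rep α) (w : FreeAlgebra ℂ (Q.E ⊕ Q.E ⊕ Q.V)) :
    total x w = (genericTotal Q α w).map (MvPolynomial.aeval (coords x)) := by
  have h : total x = (MvPolynomial.aeval (R := ℂ) (coords x)).mapMatrix.comp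
      (genericTotal Q α) := by
    have hincl : ∀ a, (incl α (MvPolynomial (Coord Q α) ℂ) a).map
        (MvPolynomial.aeval (R := ℂ) (coords x)) = incl α ℂ a := by
      intro a
      ext p i
      simp [incl, Matrix.one_apply, apply_ite]
    ext1
    funext s
    rcases s with e | e | a <;>
      simp only [total, genericTotal, Function.comp_apply, FreeAlgebra.lift_ι_apply,
        AlgHom.mapMatrix_apply, gen, Matrix.map_mul, hincl,
        Matrix.transpose_map, AlgHom.coe_comp]
    · congr 2
      ext i j
      exact (MvPolynomial.aeval_X (R := ℂ) (coords x) ⟨e, .inl (i, j)⟩).symm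
    · congr 2
      ext i j
      exact (MvPolynomial.aeval_X (R := ℂ) (coords x) ⟨e, .inr (i, j)⟩).symm
  rw [h]
  rfl

/-- Having the same character as `x` is a Zariski closed condition. -/
theorem zariskiClosed_trace_eq (x : Q.Rep α) :
    ZariskiClosed {y : Q.Rep α | ∀ w, (total y w).trace = (total x w).trace} := by
  refine ⟨Set.range fun w => (genericTotal Q α w).trace - MvPolynomial.C (total x w).trace, ?_⟩
  ext y
  simp only [Set.mem_ofPred_eq, Set.forall_mem_range, map_sub, MvPolynomial.eval_C, sub_eq_zero]
  refine forall_congr' fun w => ?_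
  rw [total_eq_map_genericTotal y, ← AddMonoidHom.map_trace]
  rfl

theorem trace_total_act (g : Q.GGroup α) (x : Q.Rep α) (w : FreeAlgebra ℂ (Q.E ⊕ Q.E ⊕ Q.V)) :
    (total (act g x) w).trace = (total x w).trace := by
  set T := Matrix.blockDiagonal' fun a => (g a).val with hT
  set T' := Matrix.blockDiagonal' fun a => ((g a)⁻¹).val with hT'
  have hTT' : T * T' = 1 := by
    rw [hT, hT', ← Matrix.blockDiagonal'_mul]
    simp [← Pi.one_def]
  have hcomm : total (act g x) w * T = T * total x w := by
    induction w using FreeAlgebra.induction with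
    | grade0 r =>
      rw [AlgHom.commutes, AlgHom.commutes]
      exact Algebra.commutes _ _
    | grade1 s =>
      rcases s with e | e | a <;>
        simp only [total, FreeAlgebra.lift_ι_apply, gen, act] <;>
        simp only [Matrix.mul_assoc, hT, incl_transpose_mul_blockDiagonal'] <;>
        simp only [← Matrix.mul_assoc, blockDiagonal'_mul_incl] <;>
        simp [Matrix.mul_assoc]
    | mul a b ha hb =>
      rw [map_mul, map_mul, mul_assoc, hb, ← mul_assoc, ha, mul_assoc]
    | add a b ha hb =>
      rw [map_add, map_add, add_mul, mul_add, ha, hb]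
  have h : total (act g x) w = T * total x w * T' := by
    rw [← hcomm, mul_assoc, hTT', mul_one]
  rw [h, Matrix.trace_mul_comm, ← mul_assoc, mul_eq_one_comm.1 hTT', one_mul]

theorem mem_orbit_of_conj {x y : Q.Rep α} {T T' : Matrix (Σ a, Fin (α a)) (Σ a, Fin (α a)) ℂ}
    (hT' : T' * T = 1) (h : ∀ w, total y w = T * total x w * T') :
    y ∈ orbit x := by
  have hgen : ∀ s, gen (fun e => (y e).1) (fun e => (y e).2) s =
      T * gen (fun e => (x e).1) (fun e => (x e).2) s * T' := by
    intro s
    simpa [total] using h (FreeAlgebra.ι ℂ s)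
  have hidem : ∀ a, T * (incl α ℂ a * (incl α ℂ a)ᵀ) * T' = incl α ℂ a * (incl α ℂ a)ᵀ :=
    fun a => (hgen (.inr (.inr a))).symm
  have hidem' : ∀ a, T' * (incl α ℂ a * (incl α ℂ a)ᵀ) * T = incl α ℂ a * (incl α ℂ a)ᵀ := by
    intro a
    conv_lhs => rw [← hidem a]
    rw [← mul_assoc, ← mul_assoc, hT', one_mul, mul_assoc, hT', mul_one]
  have hblock : ∀ a b (M : Matrix (Fin (α a)) (Fin (α b)) ℂ),
      (incl α ℂ a)ᵀ * (incl α ℂ a * M * (incl α ℂ b)ᵀ) * incl α ℂ b = M := by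
    intro a b M
    rw [Matrix.mul_assoc, Matrix.mul_assoc, incl_transpose_mul_self, Matrix.mul_one,
      ← Matrix.mul_assoc, incl_transpose_mul_self, Matrix.one_mul]
  have hinv : ∀ a (S S' : Matrix (Σ a, Fin (α a)) (Σ a, Fin (α a)) ℂ),
      S * (incl α ℂ a * (incl α ℂ a)ᵀ) * S' = incl α ℂ a * (incl α ℂ a)ᵀ →
      (incl α ℂ a)ᵀ * S * incl α ℂ a * ((incl α ℂ a)ᵀ * S' * incl α ℂ a) = 1 := by
    intro a S S' hS
    have := congrArg (fun M => (incl α ℂ a)ᵀ * M * incl α ℂ a) hS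
    simp only [Matrix.mul_assoc, incl_transpose_mul_self, Matrix.mul_one] at this ⊢
    exact this
  refine ⟨fun a => ⟨(incl α ℂ a)ᵀ * T * incl α ℂ a, (incl α ℂ a)ᵀ * T' * incl α ℂ a,
    hinv a T T' (hidem a), hinv a T' T (hidem' a)⟩, ?_⟩
  funext e
  refine Prod.ext ?_ ?_
  · rw [← hblock _ _ (y e).1]
    have := hgen (.inl e)
    simp only [gen] at this
    rw [this]
    simp only [act, Units.inv_mk, Matrix.mul_assoc]
  · rw [← hblock _ _ (y e).2]
    have := hgen (.inr (.inl e))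
    simp only [gen] at this
    rw [this]
    simp only [act, Units.inv_mk, Matrix.mul_assoc]

theorem Irred.total_surjective {x : Q.Rep α} (hx : Irred x) : Function.Surjective (total x) := by
  let L : Matrix (Σ a, Fin (α a)) (Σ a, Fin (α a)) ℂ ≃ₐ[ℂ] Module.End ℂ ((Σ a, Fin (α a)) → ℂ) :=
    Matrix.toLinAlgEquiv'
  have htop : (L.toAlgHom.comp (total x)).range = ⊤ := by
    refine Subalgebra.eq_top_of_forall_invariant _ fun U hU => ?_
    have hgen : ∀ s, ∀ v ∈ U, gen (fun e => (x e).1) (fun e => (x e).2) s *ᵥ v ∈ U := by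
      intro s v hv
      have := hU _ ⟨FreeAlgebra.ι ℂ s, rfl⟩ v hv
      simpa [total, L] using this
    have hsum : ∀ v : (Σ a, Fin (α a)) → ℂ,
        v = ∑ a, incl α ℂ a *ᵥ ((incl α ℂ a)ᵀ *ᵥ v) := by
      intro v
      conv_lhs => rw [← Matrix.one_mulVec v, ← sum_incl_mul_transpose, Matrix.sum_mulVec]
      simp only [Matrix.mulVec_mulVec]
    have hmove : ∀ a b (M : Matrix (Fin (α a)) (Fin (α b)) ℂ) (v : Fin (α b) → ℂ),
        (incl α ℂ a * M * (incl α ℂ b)ᵀ) *ᵥ (incl α ℂ b *ᵥ v) = incl α ℂ a *ᵥ (M *ᵥ v) := by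
      intro a b M v
      rw [Matrix.mulVec_mulVec, Matrix.mul_assoc, incl_transpose_mul_self, Matrix.mul_one,
        Matrix.mulVec_mulVec]
    have hdich := hx (fun a => U.comap (Matrix.mulVecLin (incl α ℂ a))) (by
      refine fun e => ⟨fun v hv => ?_, fun v hv => ?_⟩
      · have := hgen (.inl e) _ hv
        simp only [gen, Matrix.mulVecLin_apply, hmove] at this
        exact this
      · have := hgen (.inr (.inl e)) _ hv
        simp only [gen, Matrix.mulVecLin_apply, hmove] at this
        exact this)
    rcases hdich with h | h
    · left
      rw [eq_bot_iff]
      intro v hv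
      have hzero : ∀ a, (incl α ℂ a)ᵀ *ᵥ v = 0 := by
        intro a
        rw [← Submodule.mem_bot ℂ, ← h a, Submodule.mem_comap, Matrix.mulVecLin_apply,
          Matrix.mulVec_mulVec]
        exact hgen (.inr (.inr a)) v hv
      rw [Submodule.mem_bot, hsum v]
      simp [hzero]
    · right
      rw [eq_top_iff]
      intro v _
      rw [hsum v]
      refine Submodule.sum_mem _ fun a _ => ?_
      have : (incl α ℂ a)ᵀ *ᵥ v ∈ U.comap (Matrix.mulVecLin (incl α ℂ a)) := by
        rw [h a]
        trivial
      exact this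
  intro m
  obtain ⟨w, hw⟩ := (AlgHom.range_eq_top _).1 htop (L m)
  exact ⟨w, L.injective hw⟩

theorem Irred.zariskiClosed_orbit {x : Q.Rep α} (hx : Irred x) : ZariskiClosed (orbit x) := by
  convert zariskiClosed_trace_eq x
  refine Set.Subset.antisymm ?_ fun y hy => ?_
  · rintro _ ⟨g, rfl⟩ w
    exact trace_total_act g x w
  · obtain ⟨T, T', -, hT', h⟩ :=
      AlgHom.exists_conj_of_trace_eq (total x) (total y) hx.total_surjective hy
    exact mem_orbit_of_conj hT' h

/-! ### The action and stabilizers -/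

theorem act_mul (g h : Q.GGroup α) (x : Q.Rep α) : act (g * h) x = act g (act h x) := by
  funext e
  simp [act, Matrix.mul_assoc]

theorem act_one (x : Q.Rep α) : act (1 : Q.GGroup α) x = x := by
  funext e
  simp [act]

theorem scal_val (c : ℂˣ) (a : Q.V) :
    (scal c : Q.GGroup α) a = c.val • (1 : Matrix (Fin (α a)) (Fin (α a)) ℂ) := by
  simp [scal, Algebra.algebraMap_eq_smul_one]

theorem Irred.eq_scal_of_act_eq {x : Q.Rep α} (hx : Irred x) {g : Q.GGroup α}
    (hg : act g x = x) : ∃ c : ℂˣ, g = scal c := by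
  have h1 : ∀ e, (g (Q.tgt e)).val * (x e).1 = (x e).1 * (g (Q.src e)).val := by
    intro e
    conv_rhs => rw [← congrArg Prod.fst (congrFun hg e)]
    simp [act, Matrix.mul_assoc]
  have h2 : ∀ e, (g (Q.src e)).val * (x e).2 = (x e).2 * (g (Q.tgt e)).val := by
    intro e
    conv_rhs => rw [← congrArg Prod.snd (congrFun hg e)]
    simp [act, Matrix.mul_assoc]
  by_cases hα : ∀ a, α a = 0
  · refine ⟨1, funext fun a => Units.ext ?_⟩
    ext i
    exact (Fin.cast (hα a) i).elim0
  push Not at hα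
  obtain ⟨a, ha⟩ := hα
  have : Nonempty (Fin (α a)) := ⟨⟨0, Nat.pos_of_ne_zero ha⟩⟩
  obtain ⟨c, hc⟩ := Module.End.exists_eigenvalue (Matrix.mulVecLin (g a).val)
  obtain ⟨v, hv⟩ := hc.exists_hasEigenvector
  have hmem : ∀ b (v : Fin (α b) → ℂ),
      v ∈ Module.End.eigenspace (Matrix.mulVecLin (g b).val) c ↔ (g b).val *ᵥ v = c • v := by
    intro b v
    rw [Module.End.mem_eigenspace_iff, Matrix.mulVecLin_apply]
  have hc0 : c ≠ 0 := by
    rintro rfl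
    apply hv.2
    have h0 := (hmem a v).1 hv.1
    have := congrArg (fun u => ((g a)⁻¹).val *ᵥ u) h0
    simpa [Matrix.mulVec_mulVec] using this
  have hdich := hx (fun b => Module.End.eigenspace (Matrix.mulVecLin (g b).val) c) (by
    refine fun e => ⟨fun v hv => ?_, fun v hv => ?_⟩
    · rw [hmem] at hv ⊢
      rw [Matrix.mulVec_mulVec, h1, ← Matrix.mulVec_mulVec, hv, Matrix.mulVec_smul]
    · rw [hmem] at hv ⊢
      rw [Matrix.mulVec_mulVec, h2, ← Matrix.mulVec_mulVec, hv, Matrix.mulVec_smul])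
  rcases hdich with h | h
  · exact absurd ((Submodule.mem_bot ℂ).1 (h a ▸ hv.1)) hv.2
  · refine ⟨Units.mk0 c hc0, funext fun b => Units.ext ?_⟩
    rw [scal_val]
    refine Matrix.ext_of_mulVec_single fun i => ?_
    rw [(hmem b _).1 (by rw [h b]; trivial), Matrix.smul_mulVec, Matrix.one_mulVec,
      Units.val_mk0]

theorem Irred.finiteStabilizerModScalars {x : Q.Rep α} (hx : Irred x) :
    FiniteStabilizerModScalars x := by
  refine ⟨{1}, Set.finite_singleton 1, fun g hg => ?_⟩
  obtain ⟨c, rfl⟩ := hx.eq_scal_of_act_eq hg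
  exact ⟨1, rfl, c, (mul_one _).symm⟩

/-! ### Degeneration along an invariant family of subspaces -/

/-- The invertible matrix acting by `t` on the range of the idempotent `P` and trivially on its
kernel. -/
def dilation {n : Type*} [Fintype n] [DecidableEq n] (P : Matrix n n ℂ) (hP : P * P = P)
    (t : ℂˣ) : (Matrix n n ℂ)ˣ where
  val := t.val • P + (1 - P)
  inv := t⁻¹.val • P + (1 - P)
  val_inv := by simp [mul_add, add_mul, mul_sub, sub_mul, hP, smul_smul]
  inv_val := by simp [mul_add, add_mul, mul_sub, sub_mul, hP, smul_smul]

theorem dilation_mul_mul_inv {m n : Type*} [Fintype m] [DecidableEq m] [Fintype n] [DecidableEq n]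
    {P : Matrix m m ℂ} {R : Matrix n n ℂ} (hP : P * P = P) (hR : R * R = R)
    {X : Matrix m n ℂ} (hX : P * X * R = X * R) (t : ℂˣ) :
    (dilation P hP t).val * X * ((dilation R hR t)⁻¹).val =
      (P * X * R + (1 - P) * X * (1 - R)) + t.val • (P * X * (1 - R)) := by
  change (t.val • P + (1 - P)) * X * (t⁻¹.val • R + (1 - R)) = _
  simp only [Matrix.add_mul, Matrix.mul_add, Matrix.sub_mul, Matrix.mul_sub, Matrix.smul_mul,
    Matrix.mul_smul, hX, Matrix.one_mul, Matrix.mul_one, smul_sub]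
  simp
  module

theorem exists_idempotent_matrix {n : Type*} [Fintype n] [DecidableEq n]
    (W : Submodule ℂ (n → ℂ)) :
    ∃ P : Matrix n n ℂ, (∀ v, P *ᵥ v ∈ W) ∧ ∀ v ∈ W, P *ᵥ v = v := by
  obtain ⟨p, hp⟩ := W.subtype.exists_leftInverse_of_injective W.ker_subtype
  refine ⟨LinearMap.toMatrix' (W.subtype ∘ₗ p), fun v => ?_, fun v hv => ?_⟩
  · rw [LinearMap.toMatrix'_mulVec]
    exact (p v).2
  · rw [LinearMap.toMatrix'_mulVec]
    exact congrArg Subtype.val (LinearMap.congr_fun hp ⟨v, hv⟩)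

/-- A Zariski closed set containing `x₀ + t x₁` for all `t ≠ 0` contains `x₀`. -/
theorem ZariskiClosed.mem_of_forall_add_smul_mem {S : Set (Q.Rep α)} (hS : ZariskiClosed S)
    {x₀ x₁ : Q.Rep α} (h : ∀ t : ℂˣ, x₀ + t.val • x₁ ∈ S) : x₀ ∈ S := by
  obtain ⟨F, rfl⟩ := hS
  intro f hf
  have hcont : Continuous fun t : ℂ => MvPolynomial.eval (coords (x₀ + t • x₁)) f := by
    refine (MvPolynomial.continuous_eval f).comp (continuous_pi ?_)
    rintro ⟨e, ⟨i, j⟩ | ⟨i, j⟩⟩ <;> simp only [coords] <;> simp <;> fun_prop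
  have hzero := hcont.ext_on (dense_compl_singleton (0 : ℂ)) continuous_const
    (fun t ht => h (Units.mk0 t ht) f hf)
  simpa using congrFun hzero 0

theorem irred_of_stable {x : Q.Rep α} (hclosed : ZariskiClosed (orbit x))
    (hfin : FiniteStabilizerModScalars x) : Irred x := by
  intro W hW
  by_contra! hne
  obtain ⟨⟨a, ha⟩, b, hb⟩ := hne
  choose P hPW hPid using fun a => exists_idempotent_matrix (W a)
  have hP : ∀ a, P a * P a = P a := by
    intro a
    refine Matrix.ext_of_mulVec_single fun i => ?_
    rw [← Matrix.mulVec_mulVec, hPid a _ (hPW a _)]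
  have hx1 : ∀ e, P (Q.tgt e) * (x e).1 * P (Q.src e) = (x e).1 * P (Q.src e) := by
    intro e
    refine Matrix.ext_of_mulVec_single fun i => ?_
    rw [Matrix.mul_assoc, ← Matrix.mulVec_mulVec, hPid]
    rw [← Matrix.mulVec_mulVec]
    exact (hW e).1 _ (hPW _ _)
  have hx2 : ∀ e, P (Q.src e) * (x e).2 * P (Q.tgt e) = (x e).2 * P (Q.tgt e) := by
    intro e
    refine Matrix.ext_of_mulVec_single fun i => ?_
    rw [Matrix.mul_assoc, ← Matrix.mulVec_mulVec, hPid]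
    rw [← Matrix.mulVec_mulVec]
    exact (hW e).2 _ (hPW _ _)
  let l : ℂˣ → Q.GGroup α := fun t a => dilation (P a) (hP a) t
  let x₀ : Q.Rep α := fun e =>
    (P (Q.tgt e) * (x e).1 * P (Q.src e) + (1 - P (Q.tgt e)) * (x e).1 * (1 - P (Q.src e)),
      P (Q.src e) * (x e).2 * P (Q.tgt e) + (1 - P (Q.src e)) * (x e).2 * (1 - P (Q.tgt e)))
  let x₁ : Q.Rep α := fun e =>
    (P (Q.tgt e) * (x e).1 * (1 - P (Q.src e)), P (Q.src e) * (x e).2 * (1 - P (Q.tgt e)))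
  have hlx : ∀ t, act (l t) x = x₀ + t.val • x₁ := by
    intro t
    funext e
    exact Prod.ext (dilation_mul_mul_inv _ _ (hx1 e) t) (dilation_mul_mul_inv _ _ (hx2 e) t)
  have hgraded : ∀ {m n : ℕ} {P : Matrix (Fin m) (Fin m) ℂ} {R : Matrix (Fin n) (Fin n) ℂ}
      (hP : P * P = P) (hR : R * R = R) (X : Matrix (Fin m) (Fin n) ℂ) (t : ℂˣ),
      (dilation P hP t).val * (P * X * R + (1 - P) * X * (1 - R)) *
        ((dilation R hR t)⁻¹).val = P * X * R + (1 - P) * X * (1 - R) := by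
    intro m n P R hP hR X t
    have hR' : ∀ Y : Matrix (Fin m) (Fin n) ℂ, Y * R * R = Y * R := fun Y => by
      rw [Matrix.mul_assoc, hR]
    rw [dilation_mul_mul_inv hP hR]
    · simp only [Matrix.add_mul, Matrix.mul_add, Matrix.sub_mul, Matrix.mul_sub,
        Matrix.one_mul, Matrix.mul_one, ← Matrix.mul_assoc, hP, hR']
      module
    · simp only [Matrix.add_mul, Matrix.mul_add, Matrix.sub_mul, Matrix.mul_sub,
        Matrix.one_mul, Matrix.mul_one, ← Matrix.mul_assoc, hP, hR']
      module
  have hlx₀ : ∀ t, act (l t) x₀ = x₀ := fun t =>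
    funext fun e => Prod.ext (hgraded _ _ _ t) (hgraded _ _ _ t)
  obtain ⟨g, hg⟩ : x₀ ∈ orbit x :=
    hclosed.mem_of_forall_add_smul_mem (x₁ := x₁) fun t => ⟨l t, hlx t⟩
  simp only at hg
  have hstab : ∀ t, act (g⁻¹ * l t * g) x = x := by
    intro t
    rw [act_mul, hg, act_mul, hlx₀, ← hg, ← act_mul, inv_mul_cancel, act_one]
  obtain ⟨s, hs, hcover⟩ := hfin
  choose r hrs c hrc using fun t => hcover _ (hstab t)
  have : Finite s := hs
  have : Infinite ℂˣ := .of_injective (fun n : ℕ => Units.mk0 (n + 1 : ℂ) n.cast_add_one_ne_zero)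
    fun m n h => by simpa using congrArg Units.val h
  obtain ⟨t, t', htt', hr⟩ :=
    Finite.exists_ne_map_eq_of_infinite fun t => (⟨r t, hrs t⟩ : s)
  replace hr : r t = r t' := congrArg Subtype.val hr
  have hscal : ∀ (d : ℂˣ) (h : Q.GGroup α), scal d * h = h * scal d := by
    intro d h
    funext a
    ext1
    simp [scal_val]
  have hll : ∀ a, (c t').val • (l t a).val = (c t).val • (l t' a).val := by
    have h1 : scal (c t') * l t = scal (c t) * l t' := by
      have e1 : l t = scal (c t) * (g * r t * g⁻¹) := by
        rw [← mul_assoc, ← mul_assoc, hscal _ g, mul_assoc g, ← hrc]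
        group
      have e2 : l t' = scal (c t') * (g * r t * g⁻¹) := by
        rw [hr, ← mul_assoc, ← mul_assoc, hscal _ g, mul_assoc g, ← hrc]
        group
      rw [e1, e2, ← mul_assoc, hscal (c t') (scal (c t)), mul_assoc]
    intro a
    simpa [scal_val] using congrArg Units.val (congrFun h1 a)
  have hl : ∀ (t : ℂˣ) a v, (l t a).val *ᵥ v = t.val • (P a *ᵥ v) + (v - P a *ᵥ v) := by
    intro t a v
    change (t.val • P a + (1 - P a)) *ᵥ v = _
    rw [Matrix.add_mulVec, Matrix.sub_mulVec, Matrix.smul_mulVec, Matrix.one_mulVec]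
  have hcc : (c t').val = (c t).val := by
    obtain ⟨v, -, hv⟩ := SetLike.exists_of_lt (lt_top_iff_ne_top.2 hb)
    have hne : v - P b *ᵥ v ≠ 0 := fun h => hv (sub_eq_zero.1 h ▸ hPW b v)
    have hker : P b *ᵥ (v - P b *ᵥ v) = 0 := by
      rw [Matrix.mulVec_sub, hPid b _ (hPW b v), sub_self]
    have := congrArg (fun M => M *ᵥ (v - P b *ᵥ v)) (hll b)
    simp only [Matrix.smul_mulVec, hl, hker, smul_zero, zero_add, sub_zero] at this
    exact smul_left_injective ℂ hne this
  obtain ⟨v, hvW, hv⟩ := (Submodule.ne_bot_iff _).1 ha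
  have := congrArg (fun M => M *ᵥ v) (hll a)
  simp only [Matrix.smul_mulVec, hl, hPid a _ hvW, sub_self, add_zero, smul_smul, hcc] at this
  exact htt' (Units.ext (mul_left_cancel₀ (c t).ne_zero (smul_left_injective ℂ hv this)))

end FinQuiver

theorem stable_iff_irreducible (Q : FinQuiver) (α : Q.V → ℕ) (x : Q.Rep α) :
    (ZariskiClosed (orbit x) ∧ FiniteStabilizerModScalars x) ↔ Irred x :=
  ⟨fun h => irred_of_stable h.1 h.2, fun h =>
    ⟨h.zariskiClosed_orbit, h.finiteStabilizerModScalars⟩⟩
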